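/- Upper bound for the box dimension: Let (Λ,f) be a strongly mixing C¹ conformal repeller with scale constants δ_f, λ₀, λ₁ as in (C2') and (C3'), and let s_crit be the unique zero of the pressure P(s). For every s>s_crit there is a constant c(s)>0 such that for every 0<r<δ_f and every finite subset {x₁,…,x_N}⊆Λ whose points have pairwise distances ≥ 2r one has N·(4r)^s ≤ 1/c(s). Consequently the upper box dimension of Λ is at most s_crit. -/

import Mathlib

open Filter Topology Metric Set
open scoped Classical ENNReal

noncomputable section

/-- `Df` is the conformal derivative of `f`. -/
def IsConfDeriv {Λ : Type*} [MetricSpace Λ] (f : Λ → Λ) (Df : Λ → ℝ) : Prop :=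
  ∀ x : Λ, Filter.Tendsto (fun p : Λ × Λ => dist (f p.1) (f p.2) / dist p.1 p.2)
    ((𝓝 x ×ˢ 𝓝 x) ⊓ 𝓟 {p : Λ × Λ | p.1 ≠ p.2}) (𝓝 (Df x))

/-- `Df^{(n)}_x`, the conformal derivative along the orbit. -/
def orbDeriv {Λ : Type*} [MetricSpace Λ] (f : Λ → Λ) (Df : Λ → ℝ) (n : ℕ) (x : Λ) : ℝ :=
  ∏ k ∈ Finset.range n, Df (f^[k] x)

/-- (C2): uniform expansion. -/
def UnifExpanding {Λ : Type*} [MetricSpace Λ] (f : Λ → Λ) (Df : Λ → ℝ) : Prop :=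
  ∃ C : ℝ, 0 < C ∧ ∃ β : ℝ, 1 < β ∧ ∀ (x : Λ) (n : ℕ), C * β ^ n ≤ orbDeriv f Df n x

/-- `M_n(s) = sup_y (L_sⁿ 1)(y)`. -/
def Mn {Λ : Type*} [MetricSpace Λ] (f : Λ → Λ) (Df : Λ → ℝ) (s : ℝ) (n : ℕ) : ℝ :=
  ⨆ y : Λ, ∑' x : ↥(f^[n] ⁻¹' {y}), orbDeriv f Df n (x : Λ) ^ (-s)

/-- `m_n(s) = inf_y (L_sⁿ 1)(y)`. -/
def mn {Λ : Type*} [MetricSpace Λ] (f : Λ → Λ) (Df : Λ → ℝ) (s : ℝ) (n : ℕ) : ℝ :=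
  ⨅ y : Λ, ∑' x : ↥(f^[n] ⁻¹' {y}), orbDeriv f Df n (x : Λ) ^ (-s)

/-- `N(δ)`: the minimal number of open balls of radius `δ` needed to cover the space. -/
def coverNum (Λ : Type*) [MetricSpace Λ] (δ : ℝ) : ℕ :=
  sInf {n : ℕ | ∃ t : Finset Λ, t.card = n ∧ ∀ x : Λ, ∃ c ∈ t, dist x c < δ}

/-- upper box dimension `limsup_{δ→0⁺} log N(δ) / (-log δ)`. -/
def upperBoxDim (Λ : Type*) [MetricSpace Λ] : ℝ≥0∞ :=
  Filter.limsup (fun δ : ℝ => ENNReal.ofReal (Real.log (coverNum Λ δ) / (-Real.log δ))) (𝓝[>] 0)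

lemma loc_est {Λ : Type*} [MetricSpace Λ] (hpt : ∀ x : Λ, (𝓝[≠] x).NeBot)
    (f : Λ → Λ) (Df : Λ → ℝ) (hconf : IsConfDeriv f Df) (η : ℝ) (hη : 0 < η) (x : Λ) :
    ∃ U : Set Λ, IsOpen U ∧ x ∈ U ∧
      (∀ u ∈ U, ∀ v ∈ U, u ≠ v → |dist (f u) (f v) / dist u v - Df x| < η) ∧
      ∀ u ∈ U, |Df u - Df x| < 2 * η := by
  have key : ∀ x : Λ, ∃ t ∈ 𝓝 x, ∀ u ∈ t, ∀ v ∈ t, u ≠ v →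
      |dist (f u) (f v) / dist u v - Df x| < η := by
    intro x
    have h := (Metric.tendsto_nhds.1 (hconf x)) η hη
    rw [eventually_inf_principal] at h
    replace h := eventually_prod_self_iff'.1 h
    obtain ⟨t, ht, h⟩ := h
    exact ⟨t, ht, fun u hu v hv huv => by simpa [Real.dist_eq] using h u hu v hv huv⟩
  obtain ⟨t, ht, h⟩ := key x
  obtain ⟨U, hUt, hU, hxU⟩ := _root_.mem_nhds_iff.1 ht
  refine ⟨U, hU, hxU, fun u hu v hv => h u (hUt hu) v (hUt hv), fun u hu => ?_⟩
  obtain ⟨t', ht', h'⟩ := key u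
  have hm : U ∩ t' ∈ 𝓝 u := inter_mem (hU.mem_nhds hu) ht'
  have := hpt u
  have hm2 : (U ∩ t') ∩ {u}ᶜ ∈ 𝓝[≠] u := inter_mem (nhdsWithin_le_nhds hm) self_mem_nhdsWithin
  obtain ⟨w, ⟨hw1, hw2⟩, hw3⟩ := Filter.nonempty_of_mem hm2
  have a := h u (hUt hu) w (hUt hw1) (fun e => hw3 e.symm)
  have b := h' u (mem_of_mem_nhds ht') w hw2 (fun e => hw3 e.symm)
  rw [abs_lt] at *
  constructor <;> linarith [a.1, a.2, b.1, b.2]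

lemma unif_est {Λ : Type*} [MetricSpace Λ] [CompactSpace Λ] (hpt : ∀ x : Λ, (𝓝[≠] x).NeBot)
    (f : Λ → Λ) (Df : Λ → ℝ) (hconf : IsConfDeriv f Df) (hD : ∀ x, 1 ≤ Df x)
    (q : ℝ) (hq : 1 < q) :
    ∃ ρ : ℝ, 0 < ρ ∧ ∀ u v : Λ, dist u v < ρ →
      Df u * dist u v ≤ q * dist (f u) (f v) ∧ Df v ≤ q * Df u := by
  have hq1 : q⁻¹ < 1 := inv_lt_one_of_one_lt₀ hq
  have hq0 : 0 < q := by linarith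
  have hqi : q * q⁻¹ = 1 := mul_inv_cancel₀ hq0.ne'
  set p := q⁻¹ with hp
  have hp0 : 0 < p := inv_pos.2 hq0
  choose U hU hxU h1 h2 using loc_est hpt f Df hconf ((1 - p) / 4) (by linarith)
  obtain ⟨ρ, hρ, hL⟩ := lebesgue_number_lemma_of_metric (s := (Set.univ : Set Λ)) isCompact_univ hU
    (fun x _ => mem_iUnion.2 ⟨x, hxU x⟩)
  refine ⟨ρ, hρ, fun u v huv => ?_⟩
  obtain ⟨x, hx⟩ := hL u (mem_univ _)
  have hu : u ∈ U x := hx (mem_ball_self hρ)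
  have hv : v ∈ U x := hx (by rw [mem_ball, dist_comm]; exact huv)
  have a := h2 x u hu
  have b := h2 x v hv
  have hDu := hD u
  rw [abs_lt] at a b
  have h4 : Df v ≤ Df u + (1 - p) := by linarith [a.1, b.2]
  constructor
  · by_cases e : u = v
    · subst e; simp
    · have c := h1 x u hu v hv e
      rw [abs_lt] at c
      have d0 : 0 < dist u v := dist_pos.2 e
      have h5 : Df u - (1 - p) ≤ dist (f u) (f v) / dist u v := by linarith [a.2, c.1]
      rw [le_div_iff₀ d0] at h5
      have h6 : Df u ≤ q * (Df u - (1 - p)) := by nlinarith [mul_nonneg (sub_nonneg.2 hq.le) (sub_nonneg.2 hDu)]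
      calc Df u * dist u v ≤ q * (Df u - (1 - p)) * dist u v := by gcongr
        _ = q * ((Df u - (1 - p)) * dist u v) := by ring
        _ ≤ _ := by gcongr
  · have : 1 + (1 - p) ≤ q := by
      have : 0 ≤ p * (q - 1) ^ 2 := by positivity
      nlinarith
    nlinarith [mul_nonneg (sub_nonneg.2 hq.le) (sub_nonneg.2 hDu)]

lemma orbDeriv_succ {Λ : Type*} [MetricSpace Λ] (f : Λ → Λ) (Df : Λ → ℝ) (n : ℕ) (x : Λ) :
    orbDeriv f Df (n + 1) x = orbDeriv f Df n (f x) * Df x := by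
  simp [orbDeriv, Finset.prod_range_succ']

lemma orbDeriv_succ' {Λ : Type*} [MetricSpace Λ] (f : Λ → Λ) (Df : Λ → ℝ) (n : ℕ) (x : Λ) :
    orbDeriv f Df (n + 1) x = orbDeriv f Df n x * Df (f^[n] x) := by
  simp [orbDeriv, Finset.prod_range_succ]

lemma orbDeriv_add {Λ : Type*} [MetricSpace Λ] (f : Λ → Λ) (Df : Λ → ℝ) (n m : ℕ) (x : Λ) :
    orbDeriv f Df (n + m) x = orbDeriv f Df n x * orbDeriv f Df m (f^[n] x) := by
  simp only [orbDeriv, Finset.prod_range_add, ← Function.iterate_add_apply]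
  simp only [add_comm]

lemma orbDeriv_ge {Λ : Type*} [MetricSpace Λ] (f : Λ → Λ) (Df : Λ → ℝ) (β : ℝ) (hβ : 0 ≤ β)
    (h : ∀ x, β ≤ Df x) (n : ℕ) (x : Λ) : β ^ n ≤ orbDeriv f Df n x := by
  have := Finset.prod_le_prod (s := Finset.range n) (f := fun _ => β) (g := fun k => Df (f^[k] x))
    (fun _ _ => hβ) (fun _ _ => h _)
  simpa [orbDeriv] using this

lemma orbDeriv_le {Λ : Type*} [MetricSpace Λ] (f : Λ → Λ) (Df : Λ → ℝ) (B : ℝ)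
    (h0 : ∀ x, 0 ≤ Df x) (h : ∀ x, Df x ≤ B) (n : ℕ) (x : Λ) : orbDeriv f Df n x ≤ B ^ n := by
  have := Finset.prod_le_prod (s := Finset.range n) (g := fun _ => B) (f := fun k => Df (f^[k] x))
    (fun _ _ => h0 _) (fun _ _ => h _)
  simpa [orbDeriv] using this

lemma branch {Λ : Type*} [MetricSpace Λ] (f : Λ → Λ) (Df : Λ → ℝ) (hD : ∀ x, 1 ≤ Df x)
    (q ρ lam₀ δf : ℝ) (hq : 1 < q) (hρδ : ρ ≤ δf) (hlam₀ : 1 < lam₀)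
    (hρ : ∀ u v : Λ, dist u v < ρ →
      Df u * dist u v ≤ q * dist (f u) (f v) ∧ Df v ≤ q * Df u)
    (hC2 : ∀ u v : Λ, u ≠ v → dist u v < δf → lam₀ ≤ dist (f u) (f v) / dist u v)
    (hC3 : ∀ x : Λ, ball (f x) δf ⊆ f '' ball x δf) (n : ℕ) :
    ∀ x w : Λ, dist (f^[n] x) w < ρ → ∃ u, f^[n] u = w ∧ dist x u < ρ ∧
      orbDeriv f Df n x * dist x u ≤ q ^ n * dist (f^[n] x) w ∧
      orbDeriv f Df n u ≤ q ^ n * orbDeriv f Df n x := by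
  have hD0 : ∀ n x, 0 ≤ orbDeriv f Df n x := fun n x => by
    have := orbDeriv_ge f Df 1 zero_le_one hD n x
    simp at this; linarith
  induction n with
  | zero => intro x w h; exact ⟨w, by simp, by simpa using h, by simp [orbDeriv], by simp [orbDeriv]⟩
  | succ n ih =>
    intro x w h
    rw [Function.iterate_succ_apply] at h
    obtain ⟨u', h1, h2, h3, h4⟩ := ih (f x) w h
    obtain ⟨u, hu, rfl⟩ := hC3 x (show u' ∈ ball (f x) δf by
      rw [mem_ball, dist_comm]; linarith)
    rw [mem_ball, dist_comm] at hu
    have hxu : dist x u < ρ := by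
      by_cases e : x = u
      · subst e; simpa using h2
      · have := hC2 x u e hu
        have d0 : 0 < dist x u := dist_pos.2 e
        rw [le_div_iff₀ d0] at this
        nlinarith
    obtain ⟨a, b⟩ := hρ x u hxu
    refine ⟨u, by rw [Function.iterate_succ_apply]; exact h1, hxu, ?_, ?_⟩
    · rw [orbDeriv_succ, Function.iterate_succ_apply]
      calc orbDeriv f Df n (f x) * Df x * dist x u = orbDeriv f Df n (f x) * (Df x * dist x u) := by ring
        _ ≤ orbDeriv f Df n (f x) * (q * dist (f x) (f u)) := mul_le_mul_of_nonneg_left a (hD0 _ _)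
        _ = q * (orbDeriv f Df n (f x) * dist (f x) (f u)) := by ring
        _ ≤ q * (q ^ n * dist (f^[n] (f x)) w) := by gcongr
        _ = _ := by ring
    · rw [orbDeriv_succ, orbDeriv_succ]
      calc orbDeriv f Df n (f u) * Df u ≤ (q ^ n * orbDeriv f Df n (f x)) * (q * Df x) := by
            have := hD u
            have := hD0 n (f x)
            have := hD x
            gcongr
        _ = _ := by ring

lemma fib_card {Λ : Type*} [MetricSpace Λ] [CompactSpace Λ] (f : Λ → Λ)
    (lam₀ δf : ℝ) (hlam₀ : 1 < lam₀) (hδf : 0 < δf)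
    (hC2 : ∀ u v : Λ, u ≠ v → dist u v < δf → lam₀ ≤ dist (f u) (f v) / dist u v)
    (hfib : ∀ y : Λ, (f ⁻¹' {y}).Finite) :
    ∃ K : ℕ, ∀ (n : ℕ) (y : Λ), ∃ F : Finset Λ, (F : Set Λ) = f^[n] ⁻¹' {y} ∧ F.card ≤ K ^ n := by
  obtain ⟨T, -, hTf, hT⟩ := finite_cover_balls_of_compact (X := Λ) isCompact_univ (half_pos hδf)
  refine ⟨hTf.toFinset.card, fun n => ?_⟩
  have hc : ∀ x : Λ, ∃ c ∈ T, dist x c < δf / 2 := fun x => by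
    simpa using hT (mem_univ x)
  choose g hgT hg using hc
  have h1 : ∀ y, (hfib y).toFinset.card ≤ hTf.toFinset.card := by
    intro y
    refine Finset.card_le_card_of_injOn g (fun x _ => by simpa using hgT x) ?_
    intro u hu v hv e
    by_contra hne
    simp at hu hv
    have h1 := hg u
    have h2 := hg v
    rw [← e] at h2
    have := hC2 u v hne (by linarith [dist_triangle_right u v (g u)])
    rw [hu, hv, dist_self, zero_div] at this
    linarith
  induction n with
  | zero => intro y; exact ⟨{y}, by ext; simp, by simp⟩
  | succ n ih =>
    intro y
    obtain ⟨F, hF, hcard⟩ := ih y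
    refine ⟨F.biUnion (fun z => (hfib z).toFinset), ?_, ?_⟩
    · ext x
      have : f x ∈ (F : Set Λ) ↔ f^[n] (f x) = y := by rw [hF]; simp
      simp at this
      simp [this]
    · calc _ ≤ F.card * hTf.toFinset.card := Finset.card_biUnion_le_card_mul _ _ _ (fun z _ => h1 z)
        _ ≤ _ := by rw [pow_succ]; gcongr

lemma tsum_fib {Λ : Type*} (F : Finset Λ) (S : Set Λ) (h : (F : Set Λ) = S) (g : Λ → ℝ) :
    ∑' x : ↥S, g x = ∑ x ∈ F, g x := by
  subst h
  exact Finset.tsum_subtype' F g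

lemma Mn_facts {Λ : Type*} [MetricSpace Λ] [Nonempty Λ] (f : Λ → Λ) (Df : Λ → ℝ)
    (hsurj : Function.Surjective f) (β : ℝ) (hβ : 1 < β) (hD : ∀ x, β ≤ Df x) (K : ℕ)
    (hK : ∀ (n : ℕ) (y : Λ), ∃ F : Finset Λ, (F : Set Λ) = f^[n] ⁻¹' {y} ∧ F.card ≤ K ^ n)
    (s : ℝ) (hs : 0 ≤ s) (n : ℕ) :
    (∀ (y : Λ) (G : Finset Λ), (∀ x ∈ G, f^[n] x = y) →
      ∑ x ∈ G, orbDeriv f Df n x ^ (-s) ≤ Mn f Df s n) ∧ 0 < Mn f Df s n := by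
  have hD1 : ∀ x, 1 ≤ orbDeriv f Df n x := fun x => by
    simpa using orbDeriv_ge f Df 1 zero_le_one (fun x => hβ.le.trans (hD x)) n x
  have hbdd : BddAbove (range fun y : Λ => ∑' x : ↥(f^[n] ⁻¹' {y}), orbDeriv f Df n (x : Λ) ^ (-s)) := by
    refine ⟨(K : ℝ) ^ n, ?_⟩
    rintro _ ⟨y, rfl⟩
    obtain ⟨F, hF, hc⟩ := hK n y
    dsimp only
    rw [tsum_fib F _ hF (fun x => orbDeriv f Df n x ^ (-s))]
    calc _ ≤ ∑ x ∈ F, (1 : ℝ) := Finset.sum_le_sum fun x _ =>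
          Real.rpow_le_one_of_one_le_of_nonpos (hD1 x) (by linarith)
      _ = F.card := by simp
      _ ≤ _ := by exact_mod_cast hc
  have hle : ∀ (y : Λ) (G : Finset Λ), (∀ x ∈ G, f^[n] x = y) →
      ∑ x ∈ G, orbDeriv f Df n x ^ (-s) ≤ Mn f Df s n := by
    intro y G hG
    obtain ⟨F, hF, hc⟩ := hK n y
    refine le_trans ?_ (le_ciSup hbdd y)
    rw [tsum_fib F _ hF (fun x => orbDeriv f Df n x ^ (-s))]
    refine Finset.sum_le_sum_of_subset_of_nonneg ?_ (fun x _ _ =>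
      Real.rpow_nonneg (by linarith [hD1 x]) _)
    intro x hx
    have : x ∈ (F : Set Λ) := by rw [hF]; exact hG x hx
    simpa using this
  refine ⟨hle, ?_⟩
  obtain ⟨x⟩ := ‹Nonempty Λ›
  have := hle (f^[n] x) {x} (by simp)
  simp at this
  exact lt_of_lt_of_le (Real.rpow_pos_of_pos (by linarith [hD1 x]) _) this

lemma Mn_comp {Λ : Type*} [MetricSpace Λ] [Nonempty Λ] (f : Λ → Λ) (Df : Λ → ℝ)
    (hsurj : Function.Surjective f) (β : ℝ) (hβ : 1 < β) (hD : ∀ x, β ≤ Df x) (K : ℕ)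
    (hK : ∀ (n : ℕ) (y : Λ), ∃ F : Finset Λ, (F : Set Λ) = f^[n] ⁻¹' {y} ∧ F.card ≤ K ^ n)
    (s₀ s : ℝ) (hs : 0 ≤ s₀) (hss : s₀ ≤ s) (n : ℕ) :
    Mn f Df s n ≤ (β ^ n) ^ (-(s - s₀)) * Mn f Df s₀ n := by
  refine ciSup_le fun y => ?_
  obtain ⟨F, hF, hc⟩ := hK n y
  rw [tsum_fib F _ hF (fun x => orbDeriv f Df n x ^ (-s))]
  have hβn : 0 < β ^ n := by positivity
  calc _ ≤ ∑ x ∈ F, (β ^ n) ^ (-(s - s₀)) * orbDeriv f Df n x ^ (-s₀) := by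
        refine Finset.sum_le_sum fun x _ => ?_
        have h1 := orbDeriv_ge f Df β (by linarith) hD n x
        have h0 : 0 < orbDeriv f Df n x := by linarith
        rw [show -s = -(s - s₀) + -s₀ by ring, Real.rpow_add h0]
        refine mul_le_mul_of_nonneg_right ?_ (Real.rpow_nonneg h0.le _)
        exact Real.rpow_le_rpow_of_nonpos hβn h1 (by linarith)
    _ = (β ^ n) ^ (-(s - s₀)) * ∑ x ∈ F, orbDeriv f Df n x ^ (-s₀) := by rw [Finset.mul_sum]
    _ ≤ _ := by
        refine mul_le_mul_of_nonneg_left ?_ (Real.rpow_nonneg hβn.le _)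
        refine (Mn_facts f Df hsurj β hβ hD K hK s₀ hs n).1 y F fun x hx => ?_
        have : x ∈ (F : Set Λ) := by simpa using hx
        rw [hF] at this
        exact this

lemma box_from_sep (Λ : Type*) [MetricSpace Λ] [Nonempty Λ] (scrit δf : ℝ)
    (hscrit : 0 ≤ scrit) (hδf : 0 < δf)
    (H : ∀ s : ℝ, scrit < s → ∃ c : ℝ, 0 < c ∧
      ∀ r : ℝ, 0 < r → r < δf → ∀ t : Finset Λ,
        (∀ x ∈ t, ∀ y ∈ t, x ≠ y → 2 * r ≤ dist x y) →
        (t.card : ℝ) * (4 * r) ^ s ≤ 1 / c) :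
    upperBoxDim Λ ≤ ENNReal.ofReal scrit := by
  have key : ∀ s₁ : ℝ, scrit < s₁ → upperBoxDim Λ ≤ ENNReal.ofReal s₁ := by
    intro s₁ hs₁
    obtain ⟨s, hs, hss⟩ := exists_between hs₁
    obtain ⟨c, hc, h⟩ := H s hs
    have hcov : ∀ δ : ℝ, 0 < δ → δ < δf → (coverNum Λ δ : ℝ) * (2 * δ) ^ s ≤ 1 / c := by
      intro δ h0 h1
      have hp : 0 < (2 * δ) ^ s := by positivity
      let Q : Finset Λ → Prop := fun t => ∀ x ∈ t, ∀ y ∈ t, x ≠ y → δ ≤ dist x y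
      have hQ : ∀ t, Q t → (t.card : ℝ) * (2 * δ) ^ s ≤ 1 / c := fun t ht => by
        have := h (δ / 2) (by linarith) (by linarith) t (fun x hx y hy e => by
          linarith [ht x hx y hy e])
        rwa [show 4 * (δ / 2) = 2 * δ by ring] at this
      let A : Set ℕ := {n | ∃ t, Q t ∧ t.card = n}
      have hA : A.Nonempty := ⟨0, ∅, by simp [Q], rfl⟩
      have hAb : BddAbove A := by
        refine ⟨⌈1 / c / (2 * δ) ^ s⌉₊, ?_⟩
        rintro _ ⟨t, ht, rfl⟩
        have := hQ t ht
        rw [← le_div_iff₀ hp] at this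
        exact_mod_cast this.trans (Nat.le_ceil _)
      obtain ⟨t, ht, hcard⟩ := Nat.sSup_mem hA hAb
      have hcovers : ∀ x : Λ, ∃ c ∈ t, dist x c < δ := by
        intro x
        by_contra! hx
        have hxt : x ∉ t := fun hxt => by
          have := hx x hxt
          rw [dist_self] at this; linarith
        have hin : Q (insert x t) := by
          intro a ha b hb e
          rw [Finset.mem_insert] at ha hb
          rcases ha with rfl | ha <;> rcases hb with rfl | hb
          · exact absurd rfl e
          · exact hx b hb
          · rw [dist_comm]; exact hx a ha
          · exact ht a ha b hb e
        have := le_csSup hAb ⟨_, hin, rfl⟩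
        rw [Finset.card_insert_of_notMem hxt] at this
        omega
      have : coverNum Λ δ ≤ t.card := Nat.sInf_le ⟨t, rfl, hcovers⟩
      refine le_trans ?_ (hQ t ht)
      gcongr
    have hlim : Tendsto (fun δ : ℝ => -Real.log δ) (𝓝[>] 0) atTop :=
      tendsto_neg_atBot_atTop.comp Real.tendsto_log_nhdsGT_zero
    refine limsup_le_of_le (h := ?_)
    have e1 : ∀ᶠ δ : ℝ in 𝓝[>] 0, δ < δf := nhdsWithin_le_nhds (eventually_lt_nhds hδf)
    filter_upwards [e1, self_mem_nhdsWithin, hlim.eventually_gt_atTop 0,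
      hlim.eventually_ge_atTop (|Real.log (1 / c) - s * Real.log 2| / (s₁ - s))] with δ h1 h0 h2 h3
    have h0 : 0 < δ := h0
    refine ENNReal.ofReal_le_ofReal ?_
    rw [div_le_iff₀ h2]
    rw [div_le_iff₀ (by linarith)] at h3
    have h4 := le_abs_self (Real.log (1 / c) - s * Real.log 2)
    have hN := hcov δ h0 h1
    rcases Nat.eq_zero_or_pos (coverNum Λ δ) with hz | hz
    · rw [hz]; simp only [Nat.cast_zero, Real.log_zero]
      exact mul_nonneg (by linarith) h2.le
    · have hz : (0 : ℝ) < coverNum Λ δ := by exact_mod_cast hz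
      have := Real.log_le_log (by positivity) hN
      rw [Real.log_mul hz.ne' (by positivity), Real.log_rpow (by positivity),
        Real.log_mul (by norm_num) h0.ne'] at this
      nlinarith
  have ht : Tendsto (fun s => ENNReal.ofReal s) (𝓝[>] scrit) (𝓝 (ENNReal.ofReal scrit)) :=
    (ENNReal.continuous_ofReal.tendsto _).mono_left nhdsWithin_le_nhds
  exact ge_of_tendsto ht (by filter_upwards [self_mem_nhdsWithin] with s hs using key s hs)

lemma per_point {Λ : Type*} [MetricSpace Λ] [CompactSpace Λ]
    (f : Λ → Λ) (Df : Λ → ℝ)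
    (hmix : ∀ δ : ℝ, 0 < δ → ∃ n₀ : ℕ, ∀ x : Λ, f^[n₀] '' ball x δ = Set.univ)
    (β lam₀ δf B q ρ : ℝ)
    (hβ : 1 < β) (hDfβ : ∀ x : Λ, β ≤ Df x)
    (hB : ∀ x : Λ, Df x ≤ B) (hB1 : 1 ≤ B)
    (hlam₀ : 1 < lam₀) (hδf : 0 < δf)
    (hC2 : ∀ u v : Λ, u ≠ v → dist u v < δf → lam₀ ≤ dist (f u) (f v) / dist u v)
    (hC3 : ∀ x : Λ, ball (f x) δf ⊆ f '' ball x δf)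
    (hq : 1 < q) (hqβ : q < β) (hρ0 : 0 < ρ) (hρδ : ρ ≤ δf)
    (hρ : ∀ u v : Λ, dist u v < ρ →
      Df u * dist u v ≤ q * dist (f u) (f v) ∧ Df v ≤ q * Df u) (z : Λ) :
    ∃ C : ℝ, 0 < C ∧ ∀ r : ℝ, 0 < r → r < δf → ∀ x : Λ, ∃ (m : ℕ) (y : Λ),
      dist x y < r ∧ f^[m] y = z ∧ r * orbDeriv f Df m y ≤ C * q ^ (2 * m) := by
  obtain ⟨n₀, hn₀⟩ := hmix ρ hρ0
  have hD1 : ∀ x, 1 ≤ Df x := fun x => hβ.le.trans (hDfβ x)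
  have hq0 : 0 < q := by linarith
  refine ⟨(B * ρ + δf) * B ^ n₀, by positivity, fun r hr hrδ x => ?_⟩
  have hex : ∃ n : ℕ, q ^ n * ρ < r * orbDeriv f Df n x := by
    have h1 : 1 < β / q := (one_lt_div hq0).2 hqβ
    obtain ⟨n, hn⟩ := ((tendsto_pow_atTop_atTop_of_one_lt h1).eventually_gt_atTop (ρ / r)).exists
    refine ⟨n, ?_⟩
    rw [div_pow, div_lt_div_iff₀ hr (by positivity)] at hn
    have := mul_le_mul_of_nonneg_left (orbDeriv_ge f Df β (by linarith) hDfβ n x) hr.le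
    nlinarith
  obtain ⟨n, hn, hmin⟩ : ∃ n : ℕ, q ^ n * ρ < r * orbDeriv f Df n x ∧
      r * orbDeriv f Df n x ≤ (B * ρ + δf) * q ^ n := by
    refine ⟨Nat.find hex, Nat.find_spec hex, ?_⟩
    rcases hk : Nat.find hex with _ | k
    · simp [orbDeriv]; nlinarith [mul_pos (lt_of_lt_of_le one_pos hB1) hρ0]
    · have := Nat.find_min hex (m := k) (by omega)
      push Not at this
      rw [orbDeriv_succ']
      have h0 : 0 ≤ orbDeriv f Df k x := by
        have := orbDeriv_ge f Df 1 zero_le_one hD1 k x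
        simp at this; linarith
      have hqk : q ^ k ≤ q ^ (k + 1) := pow_le_pow_right₀ hq.le (by omega)
      calc r * (orbDeriv f Df k x * Df (f^[k] x)) ≤ r * (orbDeriv f Df k x * B) := by
            gcongr; exact hB _
        _ = (r * orbDeriv f Df k x) * B := by ring
        _ ≤ (q ^ k * ρ) * B := by gcongr
        _ ≤ (q ^ (k + 1) * ρ) * B := by gcongr
        _ ≤ _ := by nlinarith [mul_pos hδf (pow_pos hq0 (k + 1))]
  obtain ⟨w, hw, hwz⟩ : z ∈ f^[n₀] '' ball (f^[n] x) ρ := by rw [hn₀]; trivial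
  rw [mem_ball, dist_comm] at hw
  obtain ⟨u, hu1, hu2, hu3, hu4⟩ := branch f Df hD1 q ρ lam₀ δf hq hρδ hlam₀ hρ hC2 hC3 n x w hw
  have hDn : 1 ≤ orbDeriv f Df n x := by simpa using orbDeriv_ge f Df 1 zero_le_one hD1 n x
  refine ⟨n + n₀, u, ?_, ?_, ?_⟩
  · have h1 : q ^ n * dist (f^[n] x) w ≤ q ^ n * ρ := by gcongr
    have h2 : orbDeriv f Df n x * dist x u < orbDeriv f Df n x * r := by linarith
    exact lt_of_mul_lt_mul_left h2 (by linarith)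
  · rw [add_comm, Function.iterate_add_apply, hu1, hwz]
  · rw [orbDeriv_add]
    have h1 := orbDeriv_le f Df B (fun x => by linarith [hD1 x]) hB n₀ (f^[n] u)
    have h0 : 0 ≤ orbDeriv f Df n₀ (f^[n] u) := by
      have := orbDeriv_ge f Df 1 zero_le_one hD1 n₀ (f^[n] u)
      simp at this; linarith
    calc r * (orbDeriv f Df n u * orbDeriv f Df n₀ (f^[n] u))
        ≤ r * ((q ^ n * orbDeriv f Df n x) * B ^ n₀) := by gcongr
      _ = q ^ n * B ^ n₀ * (r * orbDeriv f Df n x) := by ring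
      _ ≤ q ^ n * B ^ n₀ * ((B * ρ + δf) * q ^ n) := by gcongr
      _ = (B * ρ + δf) * B ^ n₀ * q ^ (2 * n) := by ring
      _ ≤ _ := by
        gcongr
        · exact hq.le
        · omega

/-- **Upper bound for the box dimension.** For each `s > s_crit` there is `c(s) > 0` such that
any `2r`-separated finite set (with `0 < r < δ_f`) satisfies `N·(4r)^s ≤ 1/c(s)`; hence the
upper box dimension of `Λ` is at most `s_crit`. -/
theorem box_upper_bound {Λ : Type*} [MetricSpace Λ] [CompactSpace Λ] [Nonempty Λ]
    (hpt : ∀ x : Λ, (𝓝[≠] x).NeBot)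
    (f : Λ → Λ) (Df : Λ → ℝ)
    (hcont : Continuous f) (hsurj : Function.Surjective f)
    (hconf : IsConfDeriv f Df)
    (hexp : UnifExpanding f Df)
    (hopen : IsOpenMap f)
    (hfib : ∀ y : Λ, (f ⁻¹' {y}).Finite)
    (hmix : ∀ δ : ℝ, 0 < δ → ∃ n₀ : ℕ, ∀ x : Λ, f^[n₀] '' ball x δ = Set.univ)
    (β lam₀ lam₁ δf : ℝ)
    (hβ : 1 < β) (hDfβ : ∀ x : Λ, β ≤ Df x)
    (hlam₀ : 1 < lam₀) (hlam₀β : lam₀ < β) (hδf : 0 < δf)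
    (hC2' : ∀ u v : Λ, u ≠ v → dist u v < δf →
      lam₀ ≤ dist (f u) (f v) / dist u v ∧ dist (f u) (f v) / dist u v ≤ lam₁)
    (hC3' : ∀ x : Λ, ball (f x) δf ⊆ f '' ball x δf)
    -- the common finite pressure function and its unique zero `s_crit`
    (P : ℝ → ℝ)
    (hP : ∀ s : ℝ, 0 ≤ s →
      Filter.Tendsto (fun n : ℕ => (n : ℝ)⁻¹ * Real.log (mn f Df s n))
        Filter.atTop (𝓝 (P s)) ∧
      Filter.Tendsto (fun n : ℕ => (n : ℝ)⁻¹ * Real.log (Mn f Df s n))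
        Filter.atTop (𝓝 (P s)))
    (scrit : ℝ) (hscrit₀ : 0 ≤ scrit) (hzero : P scrit = 0)
    (huniq : ∀ s : ℝ, 0 ≤ s → P s = 0 → s = scrit) :
    (∀ s : ℝ, scrit < s → ∃ c : ℝ, 0 < c ∧
      ∀ r : ℝ, 0 < r → r < δf → ∀ t : Finset Λ,
        (∀ x ∈ t, ∀ y ∈ t, x ≠ y → 2 * r ≤ dist x y) →
        (t.card : ℝ) * (4 * r) ^ s ≤ 1 / c) ∧
    upperBoxDim Λ ≤ ENNReal.ofReal scrit := by
  have hC2 : ∀ u v : Λ, u ≠ v → dist u v < δf → lam₀ ≤ dist (f u) (f v) / dist u v :=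
    fun u v h1 h2 => (hC2' u v h1 h2).1
  have hD1 : ∀ x, 1 ≤ Df x := fun x => hβ.le.trans (hDfβ x)
  have main : ∀ s : ℝ, scrit < s → ∃ c : ℝ, 0 < c ∧
      ∀ r : ℝ, 0 < r → r < δf → ∀ t : Finset Λ,
        (∀ x ∈ t, ∀ y ∈ t, x ≠ y → 2 * r ≤ dist x y) →
        (t.card : ℝ) * (4 * r) ^ s ≤ 1 / c := by
    intro s hs
    have hs0 : 0 < s := by linarith
    have hlogβ : 0 < Real.log β := Real.log_pos hβ
    obtain ⟨K, hK⟩ := fib_card f lam₀ δf hlam₀ hδf hC2 hfib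
    have hM := Mn_facts f Df hsurj β hβ hDfβ K hK s hs0.le
    have hM0 := Mn_facts f Df hsurj β hβ hDfβ K hK scrit hscrit₀
    -- negativity of the pressure
    have hPs : P s ≤ -((s - scrit) * Real.log β) := by
      have h1 := (hP s hs0.le).2
      have h2 := ((hP scrit hscrit₀).2).const_add (-((s - scrit) * Real.log β))
      rw [hzero, add_zero] at h2
      refine le_of_tendsto_of_tendsto h1 h2 ?_
      filter_upwards [eventually_gt_atTop 0] with n hn
      have hn' : (0 : ℝ) < n := by exact_mod_cast hn
      have hβn : 0 < β ^ n := by positivity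
      have := Real.log_le_log (hM n).2 (Mn_comp f Df hsurj β hβ hDfβ K hK scrit s hscrit₀ hs.le n)
      rw [Real.log_mul (Real.rpow_pos_of_pos hβn _).ne' (hM0 n).2.ne', Real.log_rpow hβn,
        Real.log_pow] at this
      calc (n : ℝ)⁻¹ * Real.log (Mn f Df s n)
          ≤ (n : ℝ)⁻¹ * (-(s - scrit) * (n * Real.log β) + Real.log (Mn f Df scrit n)) := by gcongr
        _ = _ := by field_simp
    have hneg : P s < 0 := by nlinarith [mul_pos (sub_pos.2 hs) hlogβ]
    set θ := -P s with hθ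
    have hθ0 : 0 < θ := by linarith
    set ε := min (θ / (8 * s)) (Real.log β / 2) with hε
    have hε0 : 0 < ε := by positivity
    have hεθ : ε * (8 * s) ≤ θ := by
      rw [← le_div_iff₀ (by positivity)]; exact min_le_left _ _
    have hεβ : ε < Real.log β := lt_of_le_of_lt (min_le_right _ _) (by linarith)
    set q := Real.exp ε with hqdef
    have hq : 1 < q := Real.one_lt_exp_iff.2 hε0
    have hqβ : q < β := by rwa [hqdef, ← Real.lt_log_iff_exp_lt (by linarith)]
    obtain ⟨ρ₀, hρ₀, hρ⟩ := unif_est hpt f Df hconf hD1 q hq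
    have hB : ∀ x, Df x ≤ lam₁ + 1 := by
      intro x
      obtain ⟨U, hU, hxU, h1, -⟩ := loc_est hpt f Df hconf 1 one_pos x
      have := hpt x
      have hm : U ∩ ball x δf ∈ 𝓝 x := inter_mem (hU.mem_nhds hxU) (ball_mem_nhds x hδf)
      have hm2 : (U ∩ ball x δf) ∩ {x}ᶜ ∈ 𝓝[≠] x :=
        inter_mem (nhdsWithin_le_nhds hm) self_mem_nhdsWithin
      obtain ⟨w, ⟨hw1, hw2⟩, hw3⟩ := Filter.nonempty_of_mem hm2
      have a := h1 w hw1 x hxU hw3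
      have b := (hC2' w x hw3 hw2).2
      rw [abs_lt] at a
      linarith [a.1]
    obtain ⟨z⟩ := ‹Nonempty Λ›
    have : Nonempty Λ := ⟨z⟩
    obtain ⟨C, hC, hpp⟩ := per_point f Df hmix β lam₀ δf (lam₁ + 1) q (min ρ₀ δf) hβ hDfβ hB
      ((hD1 z).trans (hB z)) hlam₀ hδf hC2 hC3' hq hqβ (lt_min hρ₀ hδf) (min_le_right _ _)
      (fun u v h => hρ u v (h.trans_le (min_le_left _ _))) z
    set a : ℕ → ℝ := fun n => (q ^ (2 * n)) ^ s * Mn f Df s n with ha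
    have hq0 : 0 < q := by linarith
    have ha0 : ∀ n, 0 ≤ a n := fun n => mul_nonneg (by positivity) (hM n).2.le
    have hqe : ∀ n : ℕ, (q ^ (2 * n)) ^ s = Real.exp (n * (2 * s * ε)) := by
      intro n
      rw [hqdef, ← Real.exp_nat_mul, ← Real.exp_mul]
      congr 1; push_cast; ring
    have hsum : Summable a := by
      have hg : Summable (fun n : ℕ => Real.exp (n * (-(θ / 4)))) :=
        Real.summable_exp_nat_mul_iff.2 (by linarith)
      refine Summable.of_norm_bounded_eventually_nat hg ?_
      have h1 := (hP s hs0.le).2.eventually_lt_const (show P s < -(θ / 2) by linarith)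
      filter_upwards [h1, eventually_gt_atTop 0] with n h1 hn
      have hn' : (0 : ℝ) < n := by exact_mod_cast hn
      rw [Real.norm_of_nonneg (ha0 n), ha]
      dsimp only
      rw [hqe, ← Real.exp_log (hM n).2, ← Real.exp_add, Real.exp_le_exp]
      rw [inv_mul_lt_iff₀ hn'] at h1
      have : (n : ℝ) * (ε * (8 * s)) ≤ n * θ := by gcongr
      nlinarith
    set S := ∑' n, a n with hS
    have hS0 : 0 ≤ S := tsum_nonneg ha0
    refine ⟨1 / (4 ^ s * (C ^ s * S) + 1), by positivity, fun r hr hrδ t ht => ?_⟩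
    rw [one_div_one_div]
    choose m y hy1 hy2 hy3 using hpp r hr hrδ
    have hDpos : ∀ n x, 0 < orbDeriv f Df n x := fun n x => by
      have := orbDeriv_ge f Df 1 zero_le_one hD1 n x
      simp at this; linarith
    have hx : ∀ x, r ^ s ≤ C ^ s * ((q ^ (2 * m x)) ^ s * orbDeriv f Df (m x) (y x) ^ (-s)) := by
      intro x
      have h0 := hDpos (m x) (y x)
      have h1 : r ≤ C * q ^ (2 * m x) * (orbDeriv f Df (m x) (y x))⁻¹ := by
        rw [← div_eq_mul_inv, le_div_iff₀ h0]; exact hy3 x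
      calc r ^ s ≤ (C * q ^ (2 * m x) * (orbDeriv f Df (m x) (y x))⁻¹) ^ s :=
            Real.rpow_le_rpow hr.le h1 hs0.le
        _ = _ := by
          rw [Real.mul_rpow (by positivity) (by positivity), Real.mul_rpow hC.le (by positivity),
            Real.inv_rpow h0.le, Real.rpow_neg h0.le, mul_assoc]
    have hinj : ∀ x ∈ t, ∀ x' ∈ t, y x = y x' → x = x' := by
      intro x hxt x' hxt' e
      by_contra hne
      have h1 := ht x hxt x' hxt' hne
      have h2 := hy1 x
      have h3 := hy1 x'
      rw [← e] at h3
      linarith [dist_triangle_right x x' (y x)]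
    have hN : (t.card : ℝ) * r ^ s ≤ C ^ s * S := by
      calc (t.card : ℝ) * r ^ s = ∑ x ∈ t, r ^ s := by simp
        _ ≤ ∑ x ∈ t, C ^ s * ((q ^ (2 * m x)) ^ s * orbDeriv f Df (m x) (y x) ^ (-s)) :=
            Finset.sum_le_sum fun x _ => hx x
        _ = C ^ s * ∑ x ∈ t, ((q ^ (2 * m x)) ^ s * orbDeriv f Df (m x) (y x) ^ (-s)) := by
            rw [Finset.mul_sum]
        _ ≤ C ^ s * S := by
            refine mul_le_mul_of_nonneg_left ?_ (by positivity)
            rw [← Finset.sum_fiberwise_of_maps_to (t := t.image m)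
              (fun x hx => Finset.mem_image_of_mem m hx)]
            refine le_trans (Finset.sum_le_sum (g := a) fun k _ => ?_)
              (hsum.sum_le_tsum _ (fun n _ => ha0 n))
            have e : ∑ x ∈ t with m x = k, ((q ^ (2 * m x)) ^ s * orbDeriv f Df (m x) (y x) ^ (-s))
                = (q ^ (2 * k)) ^ s * ∑ w ∈ (t.filter (fun x => m x = k)).image y,
                    orbDeriv f Df k w ^ (-s) := by
              rw [Finset.sum_image, Finset.mul_sum]
              · refine Finset.sum_congr rfl fun x hx => ?_
                rw [(Finset.mem_filter.1 hx).2]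
              · intro x hx x' hx' e
                exact hinj x (Finset.mem_filter.1 hx).1 x' (Finset.mem_filter.1 hx').1 e
            rw [e]
            refine mul_le_mul_of_nonneg_left ?_ (by positivity)
            refine (hM k).1 z _ fun w hw => ?_
            obtain ⟨x, hx, rfl⟩ := Finset.mem_image.1 hw
            rw [← (Finset.mem_filter.1 hx).2]
            exact hy2 x
    rw [Real.mul_rpow (by norm_num) hr.le]
    have h4 : (0 : ℝ) < 4 ^ s := by positivity
    nlinarith [mul_le_mul_of_nonneg_left hN h4.le]
  exact ⟨main, box_from_sep Λ scrit δf hscrit₀ hδf main⟩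

end
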